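/- arXiv:2307.02944 — 3 statements merged into one kernel-verified Lean document; each statement's English description precedes it below -/
import Mathlib

section
/- Let A be a bounded residuated lattice and M a maximal implicative filter of A. Then for every a ∈ A, a ∈ M if and only if ¬¬a ∈ M. -/
universe u

/-- A bounded (integral, commutative) residuated lattice: a bounded lattice
with a commutative monoid operation `mul` (with unit `⊤`) and a residuum
`himp` satisfying the residuation condition. -/
class BRL (α : Type u) extends Lattice α, BoundedOrder α where
  mul : α → α → α
  himp : α → α → α
  mul_comm : ∀ a b : α, mul a b = mul b a
  mul_assoc : ∀ a b c : α, mul (mul a b) c = mul a (mul b c)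
  mul_top : ∀ a : α, mul a ⊤ = a
  residuation : ∀ a b c : α, mul a b ≤ c ↔ a ≤ himp b c

namespace BRL

variable {α : Type u} [BRL α]

/-- `¬a := a → ⊥`. -/
def neg (a : α) : α := himp a ⊥

/-- `a + b := ¬(¬a · ¬b)`. -/
def add (a b : α) : α := neg (mul (neg a) (neg b))

/-- Powers: `a⁰ = ⊤`, `aⁿ⁺¹ = a · aⁿ`. -/
def pow (a : α) : ℕ → α
  | 0 => ⊤
  | n + 1 => mul a (pow a n)

/-- Multiples: `0.a = ⊥`, `(n+1).a = a + n.a`. -/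
def nmul : ℕ → α → α
  | 0, _ => ⊥
  | n + 1, a => add a (nmul n a)

/-- Implicative filter. -/
def IsFilter (F : Set α) : Prop :=
  ⊤ ∈ F ∧ (∀ a b : α, a ∈ F → a ≤ b → b ∈ F) ∧
    (∀ a b : α, a ∈ F → b ∈ F → mul a b ∈ F)

/-- The smallest implicative filter containing `S`. -/
def genFilter (S : Set α) : Set α := ⋂₀ {F : Set α | IsFilter F ∧ S ⊆ F}

/-- Maximal (proper) implicative filter. -/
def IsMaximal (M : Set α) : Prop :=
  IsFilter M ∧ M ≠ Set.univ ∧ ∀ G : Set α, IsFilter G → M ⊂ G → G = Set.univ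

/-- Prime (proper) implicative filter. -/
def IsPrime (P : Set α) : Prop :=
  IsFilter P ∧ P ≠ Set.univ ∧ ∀ a b : α, a ⊔ b ∈ P → a ∈ P ∨ b ∈ P

/-- Minimal prime implicative filter (minimal among prime implicative filters). -/
def IsMinimalPrime (P : Set α) : Prop :=
  IsPrime P ∧ ∀ Q : Set α, IsPrime Q → Q ⊆ P → Q = P

/-- The radical: intersection of all maximal implicative filters. -/
def Rad : Set α := {a : α | ∀ M : Set α, IsMaximal M → a ∈ M}

/-- Boolean (complemented) element. -/
def Boolean (b : α) : Prop := b ⊔ neg b = ⊤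

/-- Stone ultrafilter: an implicative filter generated by an ultrafilter of
the Boolean algebra of Boolean elements. -/
def IsStoneUltra (F : Set α) : Prop :=
  IsFilter F ∧ F = genFilter (F ∩ {b : α | Boolean b}) ∧ (⊥ : α) ∉ F ∧
    ∀ b : α, Boolean b → b ∈ F ∨ neg b ∈ F

instance : Std.Commutative (BRL.mul : α → α → α) := ⟨BRL.mul_comm⟩

instance : Std.Associative (BRL.mul : α → α → α) := ⟨BRL.mul_assoc⟩

theorem top_mul (a : α) : mul ⊤ a = a := by rw [BRL.mul_comm, mul_top]

theorem mul_le_mul_right {a b : α} (c : α) (h : a ≤ b) : mul a c ≤ mul b c :=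
  (residuation _ _ _).2 (h.trans ((residuation _ _ _).1 le_rfl))

theorem mul_le_mul {a b c d : α} (h : a ≤ b) (h' : c ≤ d) : mul a c ≤ mul b d := by
  refine (mul_le_mul_right c h).trans ?_
  rw [BRL.mul_comm b c, BRL.mul_comm b d]
  exact mul_le_mul_right b h'

theorem le_neg_neg (a : α) : a ≤ neg (neg a) := by
  refine (residuation _ _ _).1 ?_
  rw [BRL.mul_comm]
  exact (residuation _ _ _).2 le_rfl

theorem mul_neg_neg_le_bot {a c : α} (h : mul c a ≤ ⊥) : mul c (neg (neg a)) ≤ ⊥ := by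
  refine (mul_le_mul_right _ ((residuation _ _ _).1 h)).trans ?_
  rw [BRL.mul_comm]
  exact (residuation _ _ _).2 le_rfl

theorem pow_add (a : α) (m n : ℕ) : pow a (m + n) = mul (pow a m) (pow a n) := by
  induction m with
  | zero => rw [Nat.zero_add, pow, top_mul]
  | succ m ih => rw [Nat.succ_add, pow, pow, ih, BRL.mul_assoc]

theorem mul_pow_neg_neg_le_bot {a : α} (n : ℕ) {c : α} (h : mul c (pow a n) ≤ ⊥) :
    mul c (pow (neg (neg a)) n) ≤ ⊥ := by
  induction n generalizing c with
  | zero => exact h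
  | succ n ih =>
    rw [pow, ← BRL.mul_assoc]
    apply ih
    have h' : mul (mul c (pow a n)) a ≤ ⊥ := by
      rwa [BRL.mul_assoc, BRL.mul_comm (pow a n)]
    have := mul_neg_neg_le_bot h'
    rwa [BRL.mul_assoc, BRL.mul_comm (pow a n), ← BRL.mul_assoc] at this

theorem IsFilter.pow_mem {F : Set α} (hF : IsFilter F) {a : α} (ha : a ∈ F) (n : ℕ) :
    pow a n ∈ F := by
  induction n with
  | zero => exact hF.1
  | succ n ih => exact hF.2.2 _ _ ha ih

/-- The filter generated by a filter `F` and an element `a`, described through powers of `a`. -/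
theorem IsFilter.adjoin {F : Set α} (hF : IsFilter F) (a : α) :
    IsFilter {x : α | ∃ m ∈ F, ∃ n : ℕ, mul m (pow a n) ≤ x} := by
  refine ⟨⟨⊤, hF.1, 0, le_top⟩, ?_, ?_⟩
  · rintro x y ⟨m, hm, n, h⟩ hxy
    exact ⟨m, hm, n, h.trans hxy⟩
  · rintro x y ⟨m, hm, n, h⟩ ⟨m', hm', n', h'⟩
    refine ⟨mul m m', hF.2.2 _ _ hm hm', n + n', le_trans (le_of_eq ?_) (mul_le_mul h h')⟩
    rw [pow_add]
    ac_rfl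

theorem IsMaximal.exists_mul_pow_le_bot {M : Set α} (hM : IsMaximal M) {a : α} (ha : a ∉ M) :
    ∃ m ∈ M, ∃ n : ℕ, mul m (pow a n) ≤ ⊥ := by
  have hsub : M ⊆ {x : α | ∃ m ∈ M, ∃ n : ℕ, mul m (pow a n) ≤ x} :=
    fun x hx => ⟨x, hx, 0, (mul_top x).le⟩
  have hmem : a ∈ {x : α | ∃ m ∈ M, ∃ n : ℕ, mul m (pow a n) ≤ x} :=
    ⟨⊤, hM.1.1, 1, by rw [top_mul, pow, pow, mul_top]⟩
  have h := hM.2.2 _ (hM.1.adjoin a) ((Set.ssubset_iff_of_subset hsub).2 ⟨a, hmem, ha⟩)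
  exact Set.eq_univ_iff_forall.1 h ⊥

theorem mem_maximal_iff_negneg (M : Set α) (hM : IsMaximal M) :
    ∀ a : α, a ∈ M ↔ neg (neg a) ∈ M := by
  refine fun a => ⟨fun h => hM.1.2.1 _ _ h (le_neg_neg a), fun h => ?_⟩
  by_contra ha
  obtain ⟨m, hm, n, hmn⟩ := hM.exists_mul_pow_le_bot ha
  have hbot := hM.1.2.1 _ _ (hM.1.2.2 _ _ hm (hM.1.pow_mem h n)) (mul_pow_neg_neg_le_bot n hmn)
  exact hM.2.1 (Set.eq_univ_iff_forall.2 fun x => hM.1.2.1 _ _ hbot bot_le)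

end BRL
end

section
/- Let A be a bounded residuated lattice. The intersection of all minimal prime implicative filters of A (minimal with respect to inclusion among prime implicative filters) equals {⊤}. -/
universe u

namespace BRL

variable {α : Type u} [BRL α]

theorem mul_mono_left {a b : α} (h : a ≤ b) (c : α) : mul a c ≤ mul b c :=
  (residuation _ _ _).2 (h.trans ((residuation _ _ _).1 le_rfl))

theorem mul_le_left (a b : α) : mul a b ≤ a := by
  have h := mul_mono_left (le_top : b ≤ ⊤) a
  rwa [mul_comm ⊤, mul_top, mul_comm b] at h

theorem sup_mul_le {a b c d : α} (ha : mul a c ≤ d) (hb : mul b c ≤ d) : mul (a ⊔ b) c ≤ d :=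
  (residuation _ _ _).2 (sup_le ((residuation _ _ _).1 ha) ((residuation _ _ _).1 hb))

theorem mul_sup_sup_le (a b c : α) : mul (a ⊔ c) (b ⊔ c) ≤ mul a b ⊔ c := by
  refine sup_mul_le ?_ ((mul_le_left _ _).trans le_sup_right)
  rw [mul_comm]
  refine sup_mul_le ?_ ((mul_le_left _ _).trans le_sup_right)
  rw [mul_comm]
  exact le_sup_left

theorem IsFilter.setOf_sup_mem {F : Set α} (hF : IsFilter F) (c : α) :
    IsFilter {z | z ⊔ c ∈ F} :=
  ⟨hF.2.1 _ _ hF.1 le_sup_left, fun _ _ ha hab => hF.2.1 _ _ ha (sup_le_sup_right hab c),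
    fun a b ha hb => hF.2.1 _ _ (hF.2.2 _ _ ha hb) (mul_sup_sup_le a b c)⟩

theorem IsFilter.subset_setOf_sup_mem {F : Set α} (hF : IsFilter F) (c : α) :
    F ⊆ {z | z ⊔ c ∈ F} :=
  fun _ hz => hF.2.1 _ _ hz le_sup_left

theorem isFilter_singleton_top : IsFilter ({⊤} : Set α) := by
  refine ⟨rfl, fun a b ha hab => ?_, fun a b ha hb => ?_⟩
  · rw [Set.mem_singleton_iff] at ha
    exact top_le_iff.1 (ha ▸ hab)
  · rw [Set.mem_singleton_iff] at ha hb
    rw [ha, hb, mul_top]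
    rfl

theorem IsFilter.sInter {c : Set (Set α)} (hc : ∀ F ∈ c, IsFilter F) : IsFilter (⋂₀ c) :=
  ⟨fun F hF => (hc F hF).1, fun a b ha hab F hF => (hc F hF).2.1 a b (ha F hF) hab,
    fun a b ha hb F hF => (hc F hF).2.2 a b (ha F hF) (hb F hF)⟩

theorem IsFilter.sUnion {c : Set (Set α)} (hc : ∀ F ∈ c, IsFilter F)
    (hchain : IsChain (· ⊆ ·) c) (hne : c.Nonempty) : IsFilter (⋃₀ c) := by
  refine ⟨?_, ?_, ?_⟩
  · obtain ⟨F, hF⟩ := hne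
    exact ⟨F, hF, (hc F hF).1⟩
  · rintro a b ⟨F, hF, ha⟩ hab
    exact ⟨F, hF, (hc F hF).2.1 a b ha hab⟩
  · rintro a b ⟨F, hF, ha⟩ ⟨G, hG, hb⟩
    rcases hchain.total hF hG with h | h
    · exact ⟨G, hG, (hc G hG).2.2 a b (h ha) hb⟩
    · exact ⟨F, hF, (hc F hF).2.2 a b ha (h hb)⟩

/-- A filter maximal among those avoiding `a` is prime. -/
theorem IsPrime.of_maximal_notMem {a : α} {P : Set α}
    (hP : Maximal (· ∈ {F : Set α | IsFilter F ∧ a ∉ F}) P) : IsPrime P := by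
  obtain ⟨⟨hF, ha⟩, hmax⟩ := hP
  have key : ∀ c x : α, x ∉ P → x ⊔ c ∈ P → a ⊔ c ∈ P := fun c x hx hxc => by
    by_contra hac
    exact hx (hmax ⟨hF.setOf_sup_mem c, hac⟩ (hF.subset_setOf_sup_mem c) hxc)
  refine ⟨hF, fun h => ha (h ▸ Set.mem_univ a), fun x y hxy => ?_⟩
  by_contra! h
  have hay := key y x h.1 hxy
  rw [sup_comm] at hay
  have haa := key a y h.2 hay
  rw [sup_idem] at haa
  exact ha haa

theorem exists_isPrime_notMem {a : α} (ha : a ≠ ⊤) : ∃ P : Set α, IsPrime P ∧ a ∉ P := by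
  obtain ⟨P, -, hP⟩ := zorn_subset_nonempty {F : Set α | IsFilter F ∧ a ∉ F}
    (fun c hc hchain hne => ⟨⋃₀ c, ⟨IsFilter.sUnion (fun F hF => (hc hF).1) hchain hne,
      fun ⟨F, hF, haF⟩ => (hc hF).2 haF⟩, fun _ => Set.subset_sUnion_of_mem⟩)
    {⊤} ⟨isFilter_singleton_top, ha⟩
  exact ⟨P, .of_maximal_notMem hP, hP.prop.2⟩

theorem IsPrime.sInter {c : Set (Set α)} (hc : ∀ P ∈ c, IsPrime P)
    (hchain : IsChain (· ⊆ ·) c) (hne : c.Nonempty) : IsPrime (⋂₀ c) := by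
  refine ⟨IsFilter.sInter fun P hP => (hc P hP).1, fun h => ?_, fun a b hab => ?_⟩
  · obtain ⟨P, hP⟩ := hne
    exact (hc P hP).2.1 (Set.univ_subset_iff.1 (h ▸ Set.sInter_subset_of_mem hP))
  · by_contra! h
    simp only [Set.mem_sInter, not_forall] at h
    obtain ⟨⟨P, hP, haP⟩, Q, hQ, hbQ⟩ := h
    rcases hchain.total hP hQ with hPQ | hQP
    · exact ((hc P hP).2.2 a b (hab P hP)).elim haP fun hb => hbQ (hPQ hb)
    · exact ((hc Q hQ).2.2 a b (hab Q hQ)).elim (fun ha => haP (hQP ha)) hbQ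

theorem IsPrime.exists_isMinimalPrime_subset {P : Set α} (hP : IsPrime P) :
    ∃ M ⊆ P, IsMinimalPrime M := by
  obtain ⟨M, hMP, hM⟩ := zorn_superset_nonempty {P : Set α | IsPrime P}
    (fun c hc hchain hne => ⟨⋂₀ c, IsPrime.sInter hc hchain hne,
      fun _ => Set.sInter_subset_of_mem⟩) P hP
  exact ⟨M, hMP, hM.prop, fun Q hQ hQM => hQM.antisymm (hM.le_of_le hQ hQM)⟩

theorem sInter_minimal_primes :
    ⋂₀ {P : Set α | IsMinimalPrime P} = ({⊤} : Set α) := by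
  refine Set.Subset.antisymm (fun a ha => ?_) ?_
  · by_contra hne
    obtain ⟨P, hP, haP⟩ := exists_isPrime_notMem hne
    obtain ⟨M, hMP, hM⟩ := hP.exists_isMinimalPrime_subset
    exact haP (hMP (ha M hM))
  · rintro _ rfl P hP
    exact hP.1.1.1

end BRL
end

section
/- Let A be a bounded residuated lattice and k > 0. If for every a ∈ A there exists a Boolean element b ∈ A with aᵏ ≤ b ≤ k.a, then for every a ∈ A, k.a ∨ k.(¬a) = ⊤. -/
universe u

namespace BRL

variable {α : Type u} [BRL α]

theorem le_neg_iff (a b : α) : a ≤ neg b ↔ mul a b ≤ ⊥ :=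
  (residuation a b ⊥).symm

theorem le_neg_comm (a b : α) : a ≤ neg b ↔ b ≤ neg a := by
  rw [le_neg_iff, le_neg_iff, mul_comm]

theorem neg_le_neg {a b : α} (hab : a ≤ b) : neg b ≤ neg a :=
  (le_neg_comm _ _).1 (hab.trans ((le_neg_comm _ _).1 le_rfl))

theorem neg_neg_neg (a : α) : neg (neg (neg a)) = neg a :=
  le_antisymm (neg_le_neg ((le_neg_comm _ _).1 le_rfl)) ((le_neg_comm _ _).1 le_rfl)

theorem le_neg_mul_iff (a b c : α) : a ≤ neg (mul b c) ↔ mul a b ≤ neg c := by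
  rw [le_neg_iff, le_neg_iff, mul_assoc]

theorem neg_mul_neg_neg (a b : α) : neg (mul a (neg (neg b))) = neg (mul a b) :=
  eq_of_forall_le_iff fun c => by rw [le_neg_mul_iff, le_neg_mul_iff, neg_neg_neg]

theorem add_neg_neg (a b : α) : add (neg a) (neg b) = neg (mul a b) := by
  rw [add, neg_mul_neg_neg, mul_comm, neg_mul_neg_neg, mul_comm]

theorem nmul_neg (n : ℕ) (a : α) : nmul n (neg a) = neg (pow a n) := by
  induction n with
  | zero => exact (le_bot_iff.1 (by rw [← mul_top (neg _), ← le_neg_iff, pow])).symm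
  | succ n ih => rw [nmul, ih, add_neg_neg, pow]

theorem gap_implies_wlk (k : ℕ) (hk : 0 < k)
    (h : ∀ a : α, ∃ b : α, Boolean b ∧ pow a k ≤ b ∧ b ≤ nmul k a) :
    ∀ a : α, nmul k a ⊔ nmul k (neg a) = ⊤ := by
  intro a
  obtain ⟨b, hb, hab, hba⟩ := h a
  rw [nmul_neg, eq_top_iff, ← hb]
  exact sup_le_sup hba (neg_le_neg hab)

end BRL
end
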